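/- Let n ≥ 1 and m be natural numbers, let Φ be a group, and let φ : Fin m → Φ be such that φ(i) * φ(j) = φ(j) * φ(i) for all i, j, φ(i)^n = 1 for all i, and the set {φ(i) : i : Fin m} generates Φ. If moreover the cardinality of Φ equals n^m, then Φ is isomorphic to Multiplicative (Fin m → ZMod n) via an isomorphism sending φ(i) to Multiplicative.ofAdd (Pi.single i 1) for every i : Fin m. -/

import Mathlib

/-- The homomorphism from `(ℤ/nℤ)^m` determined by pairwise commuting elements `φ i` whose `n`-th
powers are trivial. -/
theorem exists_monoidHom_pi_zmod (n m : ℕ) {Φ : Type*} [Group Φ] (φ : Fin m → Φ)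
    (hcomm : ∀ i j : Fin m, φ i * φ j = φ j * φ i) (hpow : ∀ i : Fin m, φ i ^ n = 1) :
    ∃ f : Multiplicative (Fin m → ZMod n) →* Φ,
      ∀ i : Fin m, f (Multiplicative.ofAdd (Pi.single i 1)) = φ i := by
  let a : Fin m → Additive Φ := fun i => Additive.ofMul (φ i)
  have ha (i : Fin m) : zmultiplesHom (Additive Φ) (a i) n = 0 := by
    rw [zmultiplesHom_apply, natCast_zsmul]
    exact hpow i
  let g (i : Fin m) : ZMod n →+ Additive Φ := ZMod.lift n ⟨zmultiplesHom _ (a i), ha i⟩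
  have hg : Pairwise fun i j => ∀ x y, AddCommute (g i x) (g j y) := by
    intro i j _ x y
    obtain ⟨x, rfl⟩ := ZMod.intCast_surjective x
    obtain ⟨y, rfl⟩ := ZMod.intCast_surjective y
    simp only [g, ZMod.lift_coe, zmultiplesHom_apply]
    have h : AddCommute (a i) (a j) := hcomm i j
    exact (h.zsmul_left x).zsmul_right y
  refine ⟨AddMonoidHom.toMultiplicativeLeft (AddMonoidHom.noncommPiCoprod g hg), fun i => ?_⟩
  have h : AddMonoidHom.noncommPiCoprod g hg (Pi.single i 1) = a i := by
    rw [AddMonoidHom.noncommPiCoprod_single, ← Int.cast_one]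
    simp only [g, ZMod.lift_coe, zmultiplesHom_apply, one_zsmul]
  exact h


/-- Converse direction of Theorem 2: under the Abel and Order constraints and
the size hypothesis `|Φ| = n ^ m`, the group `Φ` is isomorphic to `(ℤ/nℤ)^m`
via an isomorphism matching the generators. -/
theorem stmt_9 (n m : ℕ) (hn : 1 ≤ n) {Φ : Type*} [Group Φ] (φ : Fin m → Φ)
    (habel : ∀ i j : Fin m, φ i * φ j = φ j * φ i)
    (horder : ∀ i : Fin m, φ i ^ n = 1)
    (hgen : Subgroup.closure (Set.range φ) = ⊤)
    (hcard : Nat.card Φ = n ^ m) :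
    ∃ e : Φ ≃* Multiplicative (Fin m → ZMod n),
      ∀ i : Fin m, e (φ i) = Multiplicative.ofAdd (Pi.single i 1) := by
  have : NeZero n := ⟨by omega⟩
  obtain ⟨f, hf⟩ := exists_monoidHom_pi_zmod n m φ habel horder
  have hsurj : Function.Surjective f := by
    rw [← MonoidHom.range_eq_top, eq_top_iff, ← hgen, Subgroup.closure_le]
    rintro _ ⟨i, rfl⟩
    exact ⟨_, hf i⟩
  have hbij : Function.Bijective f := by
    rw [Nat.bijective_iff_surjective_and_card]
    refine ⟨hsurj, ?_⟩
    rw [hcard, Nat.card_congr Multiplicative.toAdd]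
    simp
  refine ⟨(MulEquiv.ofBijective f hbij).symm, fun i => ?_⟩
  rw [MulEquiv.symm_apply_eq]
  exact (hf i).symm
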